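/- For n ≥ 4, the symmetric inverse monoid I({1,...,n−1}) of all injective partial maps on an (n−1)-element set is defined by the monoid presentation with generators a₁, a₂, b₁ and relations: a₂² = 1, a₁^{n−1} = 1, (a₁a₂)^{n−2} = 1, (a₂a₁^{n−2}a₂a₁)³ = 1, (a₂a₁^{n−1−j}a₂a₁^{j})² = 1 for 2 ≤ j ≤ n−3, a₁a₂a₁^{n−2}b₁a₁a₂a₁^{n−2} = a₁^{n−2}b₁a₁, (a₁^{n−2}b₁a₁a₂)² = a₁^{n−2}b₁a₁a₂a₁^{n−2}b₁a₁ = (a₂a₁^{n−2}b₁a₁)², b₁² = b₁, a₂b₁ = b₁a₂. Precisely, the quotient of the free monoid on {a₁,a₂,b₁} by the smallest congruence containing these relations is isomorphic to I({1,...,n−1}); the isomorphism is induced by sending a₁ to the (n−2)-cycle α′₁ (i ↦ i+1 for 1 ≤ i ≤ n−2, n−1 ↦ 1), a₂ to the transposition α′₂ swapping 1 and 2 and fixing 3,...,n−1, and b₁ to the partial identity β′₁ on {1,...,n−2}. -/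

import Mathlib

namespace DPSPaper

instance instMonoidPFun {V : Type*} : Monoid (V →. V) where
  mul f g := g.comp f
  one := PFun.id V
  mul_assoc a b c := (PFun.comp_assoc c b a).symm
  one_mul := PFun.comp_id
  mul_one := PFun.id_comp

/-- The geodesic distance in the star graph `S_n` on vertices `{0,1,...,n-1}`. -/
def starDist (n : ℕ) (x y : Fin n) : ℕ :=
  if x = y then 0 else if (x : ℕ) = 0 ∨ (y : ℕ) = 0 then 1 else 2

/-- Injectivity of a partial map. -/
def PInj {n : ℕ} (α : Fin n →. Fin n) : Prop :=
  ∀ ⦃x y a : Fin n⦄, a ∈ α x → a ∈ α y → x = y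

/-- `α` is a partial isometry of the star graph `S_n`. -/
def IsStarPI {n : ℕ} (α : Fin n →. Fin n) : Prop :=
  PInj α ∧ ∀ ⦃x y u v : Fin n⦄, u ∈ α x → v ∈ α y → starDist n u v = starDist n x y

/-- The set of all partial isometries of `S_n`. -/
def DPSset (n : ℕ) : Set (Fin n →. Fin n) := { α | IsStarPI α }

/-- `α₁` : fixes 0, sends `i ↦ i+1` for `1 ≤ i ≤ n-2`, and `n-1 ↦ 1`. -/
def alphaOne (n : ℕ) (hn : 3 ≤ n) : Fin n →. Fin n :=
  fun x => Part.some <|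
    if (x : ℕ) = 0 then x
    else if h : (x : ℕ) = n - 1 then ⟨1, by omega⟩
    else ⟨(x : ℕ) + 1, by have := x.isLt; omega⟩

/-- `α₂` : fixes 0 and every `i ≥ 3`, swaps 1 and 2. -/
def alphaTwo (n : ℕ) (hn : 3 ≤ n) : Fin n →. Fin n :=
  fun x => Part.some <|
    if (x : ℕ) = 1 then ⟨2, by omega⟩
    else if (x : ℕ) = 2 then ⟨1, by omega⟩
    else x

/-- `β₁` : the partial identity on `{0,1,...,n-2}`. -/
def betaOne (n : ℕ) : Fin n →. Fin n :=
  fun x => if (x : ℕ) ≤ n - 2 then Part.some x else Part.none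

/-- `β₂` : the partial identity on `{1,...,n-1}`. -/
def betaTwo (n : ℕ) : Fin n →. Fin n :=
  fun x => if (x : ℕ) = 0 then Part.none else Part.some x

/-- `γ` : domain `{0,1}`, sending `0 ↦ 1` and `1 ↦ 0`. -/
def gammaMap (n : ℕ) (hn : 3 ≤ n) : Fin n →. Fin n :=
  fun x =>
    if (x : ℕ) = 0 then Part.some ⟨1, by omega⟩
    else if (x : ℕ) = 1 then Part.some ⟨0, by omega⟩
    else Part.none

/-- The three-letter alphabet `{a₁, a₂, b₁}`. -/
inductive Gen3 : Type
  | a1 | a2 | b1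
deriving DecidableEq

abbrev W3 := FreeMonoid Gen3

def va1 : W3 := FreeMonoid.of Gen3.a1
def va2 : W3 := FreeMonoid.of Gen3.a2
def vb1 : W3 := FreeMonoid.of Gen3.b1

/-- The defining relations of the presentation of `I({1,...,n-1})`. -/
def R3 (n : ℕ) : W3 → W3 → Prop := fun u v =>
  (u = va2 ^ 2 ∧ v = 1) ∨
  (u = va1 ^ (n - 1) ∧ v = 1) ∨
  (u = (va1 * va2) ^ (n - 2) ∧ v = 1) ∨
  (u = (va2 * va1 ^ (n - 2) * va2 * va1) ^ 3 ∧ v = 1) ∨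
  (∃ j, 2 ≤ j ∧ j ≤ n - 3 ∧ u = (va2 * va1 ^ (n - 1 - j) * va2 * va1 ^ j) ^ 2 ∧ v = 1) ∨
  (u = va1 * va2 * va1 ^ (n - 2) * vb1 * va1 * va2 * va1 ^ (n - 2) ∧
    v = va1 ^ (n - 2) * vb1 * va1) ∨
  (u = (va1 ^ (n - 2) * vb1 * va1 * va2) ^ 2 ∧ v = (va2 * va1 ^ (n - 2) * vb1 * va1) ^ 2) ∨
  (u = va1 ^ (n - 2) * vb1 * va1 * va2 * va1 ^ (n - 2) * vb1 * va1 ∧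
    v = (va2 * va1 ^ (n - 2) * vb1 * va1) ^ 2) ∨
  (u = vb1 ^ 2 ∧ v = vb1) ∨
  (u = va2 * vb1 ∧ v = vb1 * va2)

/-- The cycle `α′₁` on `{1,...,n-1}` (modelled on `Fin (n-1)`, `i ↔` element `i+1`):
`i ↦ i+1` for `1 ≤ i ≤ n-2` and `n-1 ↦ 1`. -/
def cyc (m : ℕ) : Fin m →. Fin m :=
  fun i => Part.some <|
    if h : (i : ℕ) = m - 1 then ⟨0, by have := i.isLt; omega⟩
    else ⟨(i : ℕ) + 1, by have := i.isLt; omega⟩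

/-- The transposition `α′₂` swapping the elements `1` and `2` of `{1,...,n-1}`. -/
def swap01 (m : ℕ) (hm : 2 ≤ m) : Fin m →. Fin m :=
  fun i => Part.some <|
    if (i : ℕ) = 0 then ⟨1, by omega⟩
    else if (i : ℕ) = 1 then ⟨0, by omega⟩
    else i

/-- The homomorphism from the free monoid on `{a₁,a₂,b₁}` to the partial maps on an
`(n-1)`-element set, `a₁ ↦ α′₁`, `a₂ ↦ α′₂`, `b₁ ↦ β′₁` (the partial identity on
`{1,...,n-2}`). -/
def phi3 (n : ℕ) (hn : 4 ≤ n) : W3 →* (Fin (n - 1) →. Fin (n - 1)) :=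
  FreeMonoid.lift fun g =>
    match g with
    | Gen3.a1 => cyc (n - 1)
    | Gen3.a2 => swap01 (n - 1) (by omega)
    | Gen3.b1 => betaOne (n - 1)

open Equiv

/-- `s (j+l-1) * ... * s j` -/
def descProd {G : Type*} [Group G] (s : ℕ → G) (j : ℕ) : ℕ → G
  | 0 => 1
  | l + 1 => s (j + l) * descProd s j l

theorem descProd_succ' {G : Type*} [Group G] (s : ℕ → G) (j l : ℕ) :
    descProd s j (l + 1) = descProd s (j + 1) l * s j := by
  induction l with
  | zero => simp [descProd]
  | succ l ih =>
    rw [descProd, ih, descProd, ← mul_assoc]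
    congr 3; omega

theorem descProd_comm_low {G : Type*} [Group G] (s : ℕ → G) (N : ℕ)
    (hc : ∀ i j, i + 2 ≤ j → j < N → s i * s j = s j * s i) (i j l : ℕ) (hij : i + 2 ≤ j)
    (hl : j + l ≤ N) : descProd s j l * s i = s i * descProd s j l := by
  induction l with
  | zero => simp [descProd]
  | succ l ih =>
    rw [descProd, mul_assoc, ih (by omega), ← mul_assoc, ← mul_assoc,
      hc i (j + l) (by omega) (by omega)]

theorem descProd_comm_high {G : Type*} [Group G] (s : ℕ → G) (N : ℕ)
    (hc : ∀ i j, i + 2 ≤ j → j < N → s i * s j = s j * s i) (i j l : ℕ) (hij : j + l + 1 ≤ i)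
    (hl : i < N) : descProd s j l * s i = s i * descProd s j l := by
  induction l with
  | zero => simp [descProd]
  | succ l ih =>
    rw [descProd, mul_assoc, ih (by omega), ← mul_assoc, ← mul_assoc,
      hc (j + l) i (by omega) (by omega)]

theorem descProd_shift {G : Type*} [Group G] (s : ℕ → G) (N : ℕ)
    (hb : ∀ i, i + 1 < N → s i * s (i + 1) * s i = s (i + 1) * s i * s (i + 1))
    (hc : ∀ i j, i + 2 ≤ j → j < N → s i * s j = s j * s i) (i j l : ℕ) (hij : j ≤ i)
    (hil : i + 1 < j + l)
    (hl : j + l ≤ N) : descProd s j l * s (i + 1) = s i * descProd s j l := by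
  induction l with
  | zero => omega
  | succ l ih =>
    by_cases h : i + 1 < j + l
    · rw [descProd, mul_assoc, ih h (by omega), ← mul_assoc, ← mul_assoc,
        hc i (j + l) (by omega) (by omega)]
    · obtain ⟨l', rfl⟩ : ∃ l', l = l' + 1 := ⟨l - 1, by omega⟩
      obtain rfl : i = j + l' := by omega
      have e : j + (l' + 1) = j + l' + 1 := by omega
      rw [descProd, descProd, e, mul_assoc, mul_assoc,
        descProd_comm_high s N hc _ _ _ (by omega) (by omega), ← mul_assoc, ← mul_assoc,
        ← hb _ (by omega), mul_assoc, mul_assoc]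

theorem cox_kernel {G α : Type*} [Group G] [DecidableEq α] (π : G →* Perm α) (p : ℕ → α)
    (s : ℕ → G) (N : ℕ)
    (hp : ∀ i j, i ≤ N → j ≤ N → p i = p j → i = j)
    (hs : ∀ i < N, s i * s i = 1)
    (hb : ∀ i, i + 1 < N → s i * s (i + 1) * s i = s (i + 1) * s i * s (i + 1))
    (hc : ∀ i j, i + 2 ≤ j → j < N → s i * s j = s j * s i)
    (hπ : ∀ i < N, π (s i) = swap (p i) (p (i + 1))) :
    ∀ k ≤ N, ∀ g ∈ Subgroup.closure (s '' {i | i < k}), π g = 1 → g = 1 := by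
  intro k
  induction k with
  | zero => intro _ g hg _; simpa using hg
  | succ k ih =>
    intro hk g hg hg1
    have key : ∃ h ∈ Subgroup.closure (s '' {i | i < k}), ∃ j l, j + l = k + 1 ∧
        g = h * descProd s j l := by
      clear hg1
      have step : ∀ x : G, ∀ i < k + 1, (∃ h ∈ Subgroup.closure (s '' {i | i < k}),
          ∃ j l, j + l = k + 1 ∧ x = h * descProd s j l) →
          (∃ h ∈ Subgroup.closure (s '' {i | i < k}), ∃ j l, j + l = k + 1 ∧
            x * s i = h * descProd s j l) := by
        rintro _ i hi ⟨h, hh, j, l, hjl, rfl⟩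
        have mem : ∀ i < k, s i ∈ Subgroup.closure (s '' {i | i < k}) := fun i hi =>
          Subgroup.subset_closure ⟨i, hi, rfl⟩
        rcases lt_trichotomy i j with hij | rfl | hij
        · by_cases h2 : i + 2 ≤ j
          · refine ⟨h * s i, mul_mem hh (mem i (by omega)), j, l, hjl, ?_⟩
            rw [mul_assoc, descProd_comm_low s N hc _ _ _ h2 (by omega), mul_assoc]
          · obtain rfl : j = i + 1 := by omega
            refine ⟨h, hh, i, l + 1, by omega, ?_⟩
            rw [descProd_succ', mul_assoc]
        · obtain ⟨l', rfl⟩ : ∃ l', l = l' + 1 := ⟨l - 1, by omega⟩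
          refine ⟨h, hh, i + 1, l', by omega, ?_⟩
          rw [descProd_succ', mul_assoc, mul_assoc, hs i (by omega), mul_one]
        · obtain ⟨i, rfl⟩ : ∃ i', i = i' + 1 := ⟨i - 1, by omega⟩
          refine ⟨h * s i, mul_mem hh (mem i (by omega)), j, l, hjl, ?_⟩
          rw [mul_assoc, descProd_shift s N hb hc _ _ _ (by omega) (by omega) (by omega),
            mul_assoc]
      induction hg using Subgroup.closure_induction_right with
      | one => exact ⟨1, one_mem _, k + 1, 0, by omega, by simp [descProd]⟩
      | mul_right x hx y hy ihx =>
        obtain ⟨i, hi, rfl⟩ := hy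
        exact step x i hi ihx
      | mul_inv_cancel x hx y hy ihx =>
        obtain ⟨i, hi, rfl⟩ := hy
        have : (s i)⁻¹ = s i := inv_eq_of_mul_eq_one_left
          (hs i (lt_of_lt_of_le hi hk))
        rw [this]
        exact step x i hi ihx
    obtain ⟨h, hh, j, l, hjl, rfl⟩ := key
    have hfix : π h (p (k + 1)) = p (k + 1) := by
      have : h ∈ (MulAction.stabilizer (Perm α) (p (k + 1))).comap π := by
        refine (Subgroup.closure_le _).2 ?_ hh
        rintro _ ⟨i, hi, rfl⟩
        have hi : i < k := hi
        show π (s i) • p (k + 1) = p (k + 1)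
        rw [hπ i (by omega)]
        apply swap_apply_of_ne_of_ne
        · intro h; have := hp _ _ (by omega) (by omega) h; omega
        · intro h; have := hp _ _ (by omega) (by omega) h; omega
      exact this
    have hd : ∀ l, j + l ≤ k + 1 → π (descProd s j l) (p j) = p (j + l) := by
      intro l hl
      induction l with
      | zero => simp [descProd]
      | succ l ihl =>
        rw [descProd, map_mul, Perm.mul_apply, ihl (by omega), hπ _ (by omega),
          swap_apply_left]; rfl
    have : p (k + 1) = p j := by
      have := congrArg (fun σ => σ (p j)) hg1
      simp only [map_mul, Perm.mul_apply, hd l (by omega), hjl, hfix] at this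
      simpa using this
    have := hp _ _ (by omega) (by omega) this
    obtain rfl : l = 0 := by omega
    simp only [descProd, mul_one] at hg1 ⊢
    exact ih (by omega) h hh hg1

theorem cox_hom {G : Type*} [Group G] (n : ℕ) (s : ℕ → G)
    (hs : ∀ i < n, s i * s i = 1)
    (hb : ∀ i, i + 1 < n → s i * s (i + 1) * s i = s (i + 1) * s i * s (i + 1))
    (hc : ∀ i j, i + 2 ≤ j → j < n → s i * s j = s j * s i) :
    ∃ ψ : Perm (Fin (n + 1)) →* G, ∀ i : Fin n, ψ (swap i.castSucc i.succ) = s i := by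
  let p : ℕ → Fin (n + 1) := fun i => Fin.ofNat (n + 1) i
  have hpv : ∀ i ≤ n, (p i : ℕ) = i := fun i hi => Nat.mod_eq_of_lt (by omega)
  have hp : ∀ i j, i ≤ n → j ≤ n → p i = p j → i = j := by
    intro i j hi hj h
    rw [← hpv i hi, ← hpv j hj, h]
  have hpn : ∀ i j, i ≤ n → j ≤ n → i ≠ j → p i ≠ p j := fun i j hi hj h h' => h (hp i j hi hj h')
  let s' : ℕ → Perm (Fin (n + 1)) × G := fun i => (swap (p i) (p (i + 1)), s i)
  have ker := cox_kernel (MonoidHom.fst _ _) p s' n hp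
    (fun i hi => by ext1 <;> simp [s', hs i hi])
    (fun i hi => by
      refine Prod.ext ?_ (hb i hi)
      simp only [s', Prod.fst_mul]
      have h1 := hpn i (i + 1) (by omega) (by omega) (by omega)
      have h2 := hpn i (i + 2) (by omega) (by omega) (by omega)
      have h3 := hpn (i + 1) (i + 2) (by omega) (by omega) (by omega)
      rw [show i + 1 + 1 = i + 2 from rfl]
      rw [swap_comm (p (i + 1)) (p (i + 2)), swap_comm (p i) (p (i + 1)),
        swap_mul_swap_mul_swap h3.symm h2.symm, swap_comm (p (i + 1)) (p i),
        swap_comm (p (i + 2)), swap_mul_swap_mul_swap h1 h2]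
      rw [swap_comm])
    (fun i j hij hj => by
      refine Prod.ext ?_ (hc i j hij hj)
      simp only [s', Prod.fst_mul]
      refine (Perm.Disjoint.commute ?_)
      intro x
      by_cases h1 : x = p i
      · right; subst h1
        exact swap_apply_of_ne_of_ne (hpn _ _ (by omega) (by omega) (by omega))
          (hpn _ _ (by omega) (by omega) (by omega))
      by_cases h2 : x = p (i + 1)
      · right; subst h2
        exact swap_apply_of_ne_of_ne (hpn _ _ (by omega) (by omega) (by omega))
          (hpn _ _ (by omega) (by omega) (by omega))
      · left; exact swap_apply_of_ne_of_ne h1 h2)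
    (fun i hi => rfl) n le_rfl
  let H := Subgroup.closure (s' '' {i | i < n})
  let F : H →* Perm (Fin (n + 1)) := (MonoidHom.fst _ _).comp H.subtype
  have hsw : ∀ i : Fin n, s' i = (swap i.castSucc i.succ, s i) := by
    intro i
    refine Prod.ext ?_ rfl
    simp only [s']
    congr 1
    · ext; rw [hpv _ (by omega)]; rfl
    · ext; rw [hpv _ (by omega)]; rfl
  have hm : ∀ i : Fin n, (swap i.castSucc i.succ, s i) ∈ H := fun i =>
    hsw i ▸ Subgroup.subset_closure ⟨i, i.2, rfl⟩
  have hF : Function.Bijective F := by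
    constructor
    · rw [injective_iff_map_eq_one]
      rintro ⟨g, hg⟩ h
      exact Subtype.ext (ker g hg h)
    · rw [← MonoidHom.mrange_eq_top, eq_top_iff, ← Perm.mclosure_swap_castSucc_succ,
        Submonoid.closure_le]
      rintro _ ⟨i, rfl⟩
      exact ⟨⟨_, hm i⟩, rfl⟩
  let e := MulEquiv.ofBijective F hF
  refine ⟨(MonoidHom.snd _ _).comp (H.subtype.comp e.symm.toMonoidHom), fun i => ?_⟩
  have : e.symm (swap i.castSucc i.succ) = ⟨_, hm i⟩ := by
    rw [MulEquiv.symm_apply_eq]; rfl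
  simp [this]

theorem descProd_map {G H : Type*} [Group G] [Group H] (ψ : G →* H) (s : ℕ → G) (s' : ℕ → H)
    (j l : ℕ) (h : ∀ i < j + l, ψ (s i) = s' i) :
    ψ (descProd s j l) = descProd s' j l := by
  induction l with
  | zero => simp [descProd]
  | succ l ih =>
    rw [descProd, descProd, map_mul, ih (fun i hi => h i (by omega)), h _ (by omega)]

theorem pow_eq_descProd {G : Type*} [Group G] (a t : G) (l : ℕ) :
    (a * t) ^ l = a ^ l * descProd (fun i => (a ^ i)⁻¹ * t * a ^ i) 0 l := by
  induction l with
  | zero => simp [descProd]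
  | succ l ih =>
    rw [pow_succ', ih, descProd, zero_add, pow_succ' a l]
    group

theorem eq_descProd {G : Type*} [Group G] (k : ℕ) (a t : G) (ha : a ^ (k + 3) = 1)
    (hat : (a * t) ^ (k + 2) = 1) :
    a = descProd (fun i => (a ^ i)⁻¹ * t * a ^ i) 0 (k + 2) := by
  rw [pow_eq_descProd] at hat
  have h1 : a * a ^ (k + 2) = 1 := by rw [← pow_succ']; exact ha
  rw [← mul_left_cancel_iff (a := a ^ (k + 2)), hat, ← pow_succ]; exact ha

theorem rot_pow_apply (k i : ℕ) (x : Fin (k + 3)) :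
    ((finRotate (k + 3)) ^ i) x = x + (Fin.ofNat (k + 3) i) := by
  induction i with
  | zero => simp
  | succ i ih =>
    rw [pow_succ', Perm.mul_apply, ih, finRotate_apply]
    ext
    simp [Fin.val_add, add_assoc]

theorem rot_pow (k : ℕ) : (finRotate (k + 3)) ^ (k + 3) = 1 := by
  ext x
  rw [rot_pow_apply]
  simp

theorem rot_conj (k i : ℕ) (h : i < k + 2) :
    (finRotate (k + 3)) ^ i * swap 0 1 * ((finRotate (k + 3)) ^ i)⁻¹ =
      swap (⟨i, by omega⟩ : Fin (k + 3)) ⟨i + 1, by omega⟩ := by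
  rw [← swap_apply_apply, rot_pow_apply, rot_pow_apply]
  congr 1
  · ext; simp; omega
  · ext
    simp only [Fin.val_add, Fin.val_one, Fin.ofNat]
    rw [Nat.mod_eq_of_lt (show i < k + 3 by omega), Nat.mod_eq_of_lt (by omega)]; omega

theorem rot_swap_pow (k : ℕ) : ((finRotate (k + 3))⁻¹ * swap 0 1) ^ (k + 2) = 1 := by
  rw [← inv_inj, ← inv_pow, inv_one, mul_inv_rev, inv_inv, swap_inv]
  set r : Perm (Fin (k + 3)) := swap 0 1 * finRotate (k + 3) with hr
  let q : ℕ → Fin (k + 3) := fun y => ⟨1 + y % (k + 2), by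
    have := Nat.mod_lt y (show 0 < k + 2 by omega); omega⟩
  have hq : ∀ y, r (q y) = q (y + 1) := by
    intro y
    rw [hr, Perm.mul_apply, finRotate_apply]
    have hy := Nat.mod_lt y (show 0 < k + 2 by omega)
    by_cases h : y % (k + 2) = k + 1
    · have h1 : q y + 1 = 0 := by
        ext; simp [q, Fin.val_add, h]; rw [show 1 + (k + 1) + 1 = k + 3 by omega]; simp
      rw [h1, swap_apply_left]
      ext
      simp only [q, Nat.add_mod y 1, h]
      rw [Nat.mod_eq_of_lt (show 1 < k + 2 by omega)]; simp
    · have h1 : ((q y + 1 : Fin (k + 3)) : ℕ) = y % (k + 2) + 2 := by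
        simp only [q, Fin.val_add, Fin.val_one]
        rw [Nat.mod_eq_of_lt (by omega)]; omega
      rw [swap_apply_of_ne_of_ne]
      · ext
        rw [h1]
        simp only [q, Nat.add_mod y 1]
        rw [Nat.mod_eq_of_lt (show 1 < k + 2 by omega),
          Nat.mod_eq_of_lt (show y % (k + 2) + 1 < k + 2 by omega)]; omega
      · intro h2; rw [h2] at h1; simp at h1
      · intro h2; rw [h2] at h1; simp at h1
  have hql : ∀ l y, (r ^ l) (q y) = q (y + l) := by
    intro l
    induction l with
    | zero => intro y; simp
    | succ l ih => intro y; rw [pow_succ', Perm.mul_apply, ih, hq]; rfl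
  have h0 : r 0 = 0 := by
    rw [hr, Perm.mul_apply, finRotate_apply]; simp
  ext x
  by_cases hx : x = 0
  · subst hx
    rw [Perm.pow_apply_eq_self_of_apply_eq_self h0]; rfl
  · have : x = q ((x : ℕ) - 1) := by
      have := Fin.val_ne_of_ne hx
      have h2 := x.2
      ext; simp only [q]
      simp only [Fin.val_zero] at this
      rw [Nat.mod_eq_of_lt (by omega)]; omega
    rw [this, hql]
    simp [q]

theorem moore_hom {G : Type*} [Group G] (k : ℕ) (a t : G) (ht : t ^ 2 = 1) (ha : a ^ (k + 3) = 1)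
    (hat : (a * t) ^ (k + 2) = 1) (h3 : (t * a ^ (k + 2) * t * a) ^ 3 = 1)
    (hj : ∀ j, 2 ≤ j → j ≤ k + 1 → (t * a ^ (k + 3 - j) * t * a ^ j) ^ 2 = 1) :
    ∃ ψ : Perm (Fin (k + 3)) →* G, ψ (finRotate (k + 3))⁻¹ = a ∧ ψ (swap 0 1) = t := by
  have hinv : ∀ j ≤ k + 3, a ^ (k + 3 - j) = (a ^ j)⁻¹ := by
    intro j hj
    rw [eq_inv_iff_mul_eq_one, ← pow_add, Nat.sub_add_cancel hj, ha]
  have htt : t * t = 1 := by rw [← pow_two, ht]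
  let s : ℕ → G := fun i => (a ^ i)⁻¹ * t * a ^ i
  have hs : ∀ i, s i * s i = 1 := by
    intro i
    have : s i * s i = (a ^ i)⁻¹ * (t * t) * a ^ i := by simp only [s]; group
    rw [this, htt]; group
  have hsi : ∀ i, (s i)⁻¹ = s i := fun i => inv_eq_of_mul_eq_one_left (hs i)
  have hconj : ∀ i j, s (i + j) = (a ^ i)⁻¹ * s j * a ^ i := by
    intro i j; simp only [s]
    rw [add_comm i j, pow_add]; group
  have s0 : s 0 = t := by simp [s]
  have hb0 : s 0 * s 1 * s 0 = s 1 * s 0 * s 1 := by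
    have e1 : (s 0 * s 1) ^ 3 = 1 := by
      rw [← h3]
      have := hinv 1 (by omega)
      rw [show k + 3 - 1 = k + 2 by omega] at this
      rw [this]; simp only [s]
      congr 1; group
    have e2 : (s 0 * s 1 * s 0) * (s 1 * s 0 * s 1) = 1 := by
      rw [← e1]; simp only [pow_succ, pow_zero, one_mul, mul_assoc]
    rw [mul_eq_one_iff_eq_inv] at e2
    rw [e2]; simp only [mul_inv_rev, hsi, mul_assoc]
  have hc0 : ∀ j, 2 ≤ j → j ≤ k + 1 → s 0 * s j = s j * s 0 := by
    intro j h2 hjk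
    have e1 : (s 0 * s j) ^ 2 = 1 := by
      rw [← hj j h2 hjk, hinv j (by omega)]; simp only [s]
      congr 1; group
    rw [pow_two, mul_eq_one_iff_eq_inv] at e1
    rw [e1]; simp only [mul_inv_rev, hsi]
  obtain ⟨ψ, hψ⟩ := cox_hom (k + 2) s (fun i _ => hs i)
    (fun i _ => by
      have h0 := hconj i 0
      have h1 := hconj i 1
      rw [add_zero] at h0
      rw [h0, h1]
      calc _ = (a ^ i)⁻¹ * (s 0 * s 1 * s 0) * a ^ i := by group
        _ = _ := by rw [hb0]; group)
    (fun i j hij hj => by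
      have h0 := hconj i 0
      have h1 := hconj i (j - i)
      rw [add_zero] at h0
      rw [show i + (j - i) = j by omega] at h1
      rw [h0, h1]
      calc _ = (a ^ i)⁻¹ * (s 0 * s (j - i)) * a ^ i := by group
        _ = _ := by rw [hc0 (j - i) (by omega) (by omega)]; group)
  refine ⟨ψ, ?_, ?_⟩
  · rw [eq_descProd k (finRotate (k + 3))⁻¹ (swap 0 1) (by rw [inv_pow, rot_pow, inv_one])
      (rot_swap_pow k), descProd_map ψ _ s, ← eq_descProd k a t ha hat]
    intro i hi
    rw [inv_pow, inv_inv, rot_conj k i (by omega)]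
    exact hψ ⟨i, by omega⟩
  · rw [← s0]; exact hψ 0

theorem mem_of_support {α : Type*} [Fintype α] [DecidableEq α] (p : α → Prop) [DecidablePred p]
    (N : Submonoid (Perm α)) (hN : ∀ x y, p x → p y → x ≠ y → swap x y ∈ N) (σ : Perm α)
    (hσ : ∀ x, ¬ p x → σ x = x) : σ ∈ N := by
  have h1 : ∀ x, p (σ x) ↔ p x := by
    intro x
    constructor
    · intro h; by_contra hx; rw [hσ x hx] at h; exact hx h
    · intro h; by_contra hx
      have := σ.injective (hσ _ hx)
      rw [this] at hx; exact hx h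
  have h2 : Perm.ofSubtype (σ.subtypePerm h1) = σ :=
    Perm.ofSubtype_subtypePerm h1 (fun x hx => by
      by_contra h; exact hx (hσ x h))
  rw [← h2]
  induction σ.subtypePerm h1 using Perm.swap_induction_on with
  | one => simp
  | swap_mul τ x y hxy ih =>
    rw [map_mul, Perm.ofSubtype_swap_eq]
    exact mul_mem (hN x y x.2 y.2 (fun h => hxy (Subtype.ext h))) ih

section abs
variable {k : ℕ} {Q : Type*} [Monoid Q]

/-- The hypotheses on the extension of a representation of the symmetric group. -/
structure Rel3 (ψ : Perm (Fin (k + 3)) →* Q) (f : Q) : Prop where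
  h6 : ψ (finRotate (k + 3))⁻¹ * ψ (swap 0 1) * ψ (finRotate (k + 3)) * f *
    ψ (finRotate (k + 3))⁻¹ * ψ (swap 0 1) * ψ (finRotate (k + 3)) =
    ψ (finRotate (k + 3)) * f * ψ (finRotate (k + 3))⁻¹
  h7 : (ψ (finRotate (k + 3)) * f * ψ (finRotate (k + 3))⁻¹ * ψ (swap 0 1)) ^ 2 =
    (ψ (swap 0 1) * ψ (finRotate (k + 3)) * f * ψ (finRotate (k + 3))⁻¹) ^ 2
  h8 : ψ (finRotate (k + 3)) * f * ψ (finRotate (k + 3))⁻¹ * ψ (swap 0 1) *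
    ψ (finRotate (k + 3)) * f * ψ (finRotate (k + 3))⁻¹ =
    (ψ (swap 0 1) * ψ (finRotate (k + 3)) * f * ψ (finRotate (k + 3))⁻¹) ^ 2
  h9 : f * f = f
  h10 : ψ (swap 0 1) * f = f * ψ (swap 0 1)

/-- The idempotent missing `x`. -/
def Ex (ψ : Perm (Fin (k + 3)) →* Q) (f : Q) (x : Fin (k + 3)) : Q :=
  ψ (swap (Fin.last (k + 2)) x) * f * ψ (swap (Fin.last (k + 2)) x)

/-- Product of the idempotents over a list. -/
def EL (ψ : Perm (Fin (k + 3)) →* Q) (f : Q) (l : List (Fin (k + 3))) : Q :=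
  (l.map (Ex ψ f)).prod

variable {ψ : Perm (Fin (k + 3)) →* Q} {f : Q}

theorem psi_inv_mul (σ : Perm (Fin (k + 3))) : ψ σ⁻¹ * ψ σ = 1 := by
  rw [← map_mul, inv_mul_cancel, map_one]

theorem psi_mul_inv (σ : Perm (Fin (k + 3))) : ψ σ * ψ σ⁻¹ = 1 := by
  rw [← map_mul, mul_inv_cancel, map_one]

theorem psi_swap (x y : Fin (k + 3)) : ψ (swap x y) * ψ (swap x y) = 1 := by
  rw [← map_mul, swap_mul_self, map_one]

/-- The submonoid of permutations commuting with `f`. -/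
def commF (ψ : Perm (Fin (k + 3)) →* Q) (f : Q) : Submonoid (Perm (Fin (k + 3))) where
  carrier := {σ | ψ σ * f = f * ψ σ}
  one_mem' := by simp
  mul_mem' := by
    intro a b ha hb
    simp only [Set.mem_ofPred_eq, map_mul] at *
    rw [mul_assoc, hb, ← mul_assoc, ha, mul_assoc]

theorem commF_inv {σ : Perm (Fin (k + 3))} (h : σ ∈ commF ψ f) : σ⁻¹ ∈ commF ψ f := by
  have h : ψ σ * f = f * ψ σ := h
  show ψ σ⁻¹ * f = f * ψ σ⁻¹
  calc ψ σ⁻¹ * f = ψ σ⁻¹ * (f * ψ σ) * ψ σ⁻¹ := by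
        rw [mul_assoc, mul_assoc, psi_mul_inv, mul_one]
    _ = _ := by rw [← h, ← mul_assoc, psi_inv_mul, one_mul]

theorem stab_comm (R : Rel3 ψ f) (σ : Perm (Fin (k + 3)))
    (hσ : σ (Fin.last (k + 2)) = Fin.last (k + 2)) : ψ σ * f = f * ψ σ := by
  let c := finRotate (k + 3)
  let γ : Perm (Fin (k + 3)) := c⁻¹ * (c⁻¹ * swap 0 1 * c)
  have hγ : γ ∈ commF ψ f := by
    show ψ γ * f = f * ψ γ
    have h := R.h6
    calc ψ γ * f = ψ c⁻¹ * (ψ c⁻¹ * ψ (swap 0 1) * ψ c * f) *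
          (ψ c⁻¹ * (ψ (swap 0 1) * (ψ c * ψ c⁻¹) * ψ (swap 0 1)) * ψ c) := by
          rw [psi_mul_inv, mul_one, psi_swap, mul_one, psi_inv_mul, mul_one]
          simp only [γ, map_mul, mul_assoc]
      _ = ψ c⁻¹ * (ψ c⁻¹ * ψ (swap 0 1) * ψ c * f * ψ c⁻¹ * ψ (swap 0 1) * ψ c) *
          (ψ c⁻¹ * ψ (swap 0 1) * ψ c) := by simp only [mul_assoc]
      _ = (ψ c⁻¹ * ψ c) * f * (ψ c⁻¹ * (ψ c⁻¹ * ψ (swap 0 1) * ψ c)) := by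
          rw [h]; simp only [c, mul_assoc]
      _ = f * ψ γ := by
          rw [psi_inv_mul, one_mul]; simp only [γ, map_mul]
  have hγi := commF_inv hγ
  have hγa : ∀ i (h : i < k + 1), γ⁻¹ ⟨i, by omega⟩ = ⟨i + 1, by omega⟩ := by
    intro i h
    have : γ⁻¹ = c⁻¹ * (swap 0 1 * (c * c)) := by
      simp only [γ, mul_inv_rev, inv_inv, swap_inv, mul_assoc]
    rw [this, Perm.mul_apply, Perm.inv_eq_iff_eq, Perm.mul_apply, Perm.mul_apply]
    simp only [c, finRotate_apply]
    have e : ((⟨i, by omega⟩ + 1 + 1 : Fin (k + 3)) : ℕ) = i + 2 := by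
      simp only [Fin.val_add, Fin.val_one]
      rw [Nat.mod_eq_of_lt (a := i + 1) (by omega), Nat.mod_eq_of_lt (by omega)]
    have e' : ((⟨i + 1, by omega⟩ + 1 : Fin (k + 3)) : ℕ) = i + 2 := by
      simp only [Fin.val_add, Fin.val_one]
      rw [Nat.mod_eq_of_lt (by omega)]
    rw [swap_apply_of_ne_of_ne]
    · ext; rw [e, e']
    · intro h2; rw [h2] at e; simp at e
    · intro h2; rw [h2] at e; simp at e
  have hadj : ∀ i (h : i < k + 1),
      swap (⟨i, by omega⟩ : Fin (k + 3)) ⟨i + 1, by omega⟩ ∈ commF ψ f := by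
    intro i
    induction i with
    | zero => intro _; exact R.h10
    | succ i ih =>
      intro h
      have := ih (by omega)
      rw [← hγa i (by omega), ← hγa (i + 1) (by omega), swap_apply_apply, inv_inv]
      exact mul_mem (mul_mem hγi this) hγ
  have hall : ∀ d i (h : i + d + 1 < k + 2),
      swap (⟨i, by omega⟩ : Fin (k + 3)) ⟨i + d + 1, by omega⟩ ∈ commF ψ f := by
    intro d
    induction d with
    | zero => intro i h; exact hadj i (by omega)
    | succ d ih =>
      intro i h
      have h1 := ih i (by omega)
      have h2 := hadj (i + d + 1) (by omega)
      have := swap_mul_swap_mul_swap (x := (⟨i, by omega⟩ : Fin (k + 3)))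
        (y := ⟨i + d + 1, by omega⟩) (z := ⟨i + d + 1 + 1, by omega⟩)
        (by simp; omega) (by simp; omega)
      rw [swap_comm, show (⟨i + (d + 1) + 1, by omega⟩ : Fin (k + 3)) =
        ⟨i + d + 1 + 1, by omega⟩ from by ext; simp; omega, ← this]
      exact mul_mem (mul_mem h2 h1) h2
  refine mem_of_support (fun x => x ≠ Fin.last (k + 2)) (commF ψ f) ?_ σ ?_
  · have key : ∀ x y : Fin (k + 3), x ≠ Fin.last (k + 2) → y ≠ Fin.last (k + 2) → x < y →
        swap x y ∈ commF ψ f := by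
      intro x y hx hy hxy
      have hx' : (x : ℕ) ≠ k + 2 := fun h => hx (Fin.ext h)
      have hy' : (y : ℕ) ≠ k + 2 := fun h => hy (Fin.ext h)
      have hxy' : (x : ℕ) < y := hxy
      have := hall (y - x - 1) x (by omega)
      convert this using 2
      ext; simp; omega
    intro x y hx hy hxy
    rcases lt_or_gt_of_ne hxy with h | h
    · exact key x y hx hy h
    · rw [swap_comm]; exact key y x hy hx h
  · intro x hx
    simp only [not_not] at hx
    rw [hx, hσ]

theorem conj_f (R : Rel3 ψ f) (σ : Perm (Fin (k + 3))) :
    ψ σ * f * ψ σ⁻¹ = Ex ψ f (σ (Fin.last (k + 2))) := by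
  set x := σ (Fin.last (k + 2)) with hx
  have h := stab_comm R (swap (Fin.last (k + 2)) x * σ) (by
    rw [Perm.mul_apply, ← hx, swap_apply_right])
  calc ψ σ * f * ψ σ⁻¹
      = ψ (swap (Fin.last (k + 2)) x) * (ψ (swap (Fin.last (k + 2)) x * σ) * f) * ψ σ⁻¹ := by
        rw [map_mul, mul_assoc (ψ (swap _ _)) (ψ σ) f, ← mul_assoc (ψ (swap _ _)) (ψ (swap _ _)),
          psi_swap, one_mul]
    _ = Ex ψ f x := by
        rw [h, map_mul, Ex]
        simp only [mul_assoc]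
        rw [psi_mul_inv, mul_one]

theorem conj_Ex (R : Rel3 ψ f) (σ : Perm (Fin (k + 3))) (x : Fin (k + 3)) :
    ψ σ * Ex ψ f x = Ex ψ f (σ x) * ψ σ := by
  have h := conj_f R (σ * swap (Fin.last (k + 2)) x)
  rw [Perm.mul_apply, swap_apply_left] at h
  rw [← h, Ex, mul_inv_rev, swap_inv]
  simp only [map_mul, mul_assoc]
  rw [psi_inv_mul, mul_one]

theorem conj_EL (R : Rel3 ψ f) (σ : Perm (Fin (k + 3))) (l : List (Fin (k + 3))) :
    ψ σ * EL ψ f l = EL ψ f (l.map σ) * ψ σ := by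
  induction l with
  | nil => simp [EL]
  | cons x l ih =>
    simp only [EL, List.map_cons, List.prod_cons] at ih ⊢
    rw [← mul_assoc, conj_Ex R, mul_assoc, ih, mul_assoc]

theorem Ex_idem (R : Rel3 ψ f) (x : Fin (k + 3)) : Ex ψ f x * Ex ψ f x = Ex ψ f x := by
  have : Ex ψ f x * Ex ψ f x = ψ (swap (Fin.last (k + 2)) x) * (f *
    (ψ (swap (Fin.last (k + 2)) x) * ψ (swap (Fin.last (k + 2)) x)) * f) *
      ψ (swap (Fin.last (k + 2)) x) := by simp only [Ex, mul_assoc]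
  rw [this, psi_swap, mul_one, R.h9, Ex]

theorem Ex_zero (R : Rel3 ψ f) :
    ψ (finRotate (k + 3)) * f * ψ (finRotate (k + 3))⁻¹ = Ex ψ f 0 := by
  rw [conj_f R]; simp

theorem Ex01 (R : Rel3 ψ f) : Ex ψ f 0 * Ex ψ f 1 = Ex ψ f 1 * Ex ψ f 0 ∧
    Ex ψ f 0 * Ex ψ f 1 * ψ (swap 0 1) = Ex ψ f 0 * Ex ψ f 1 := by
  have h7 := R.h7
  have h8 := R.h8
  have e := Ex_zero R
  have t0 := conj_Ex R (swap 0 1) 0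
  have t1 := conj_Ex R (swap 0 1) 1
  rw [swap_apply_left] at t0
  rw [swap_apply_right] at t1
  have e2 : ψ (swap 0 1) * ψ (finRotate (k + 3)) * f * ψ (finRotate (k + 3))⁻¹ =
      Ex ψ f 1 * ψ (swap 0 1) := by rw [← t0, ← e]; simp only [mul_assoc]
  have e3 : ψ (finRotate (k + 3)) * f * ψ (finRotate (k + 3))⁻¹ * ψ (swap 0 1) *
    ψ (finRotate (k + 3)) * f * ψ (finRotate (k + 3))⁻¹ = Ex ψ f 0 * Ex ψ f 1 * ψ (swap 0 1) := by
    rw [mul_assoc (Ex ψ f 0), ← t0, ← e]; simp only [mul_assoc]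
  rw [e2, e] at h7
  rw [e2, e3] at h8
  have e4 : (Ex ψ f 0 * ψ (swap 0 1)) ^ 2 = Ex ψ f 0 * Ex ψ f 1 := by
    rw [pow_two, mul_assoc, ← mul_assoc (ψ (swap 0 1)), t0, mul_assoc, psi_swap, mul_one]
  have e5 : (Ex ψ f 1 * ψ (swap 0 1)) ^ 2 = Ex ψ f 1 * Ex ψ f 0 := by
    rw [pow_two, mul_assoc, ← mul_assoc (ψ (swap 0 1)), t1, mul_assoc, psi_swap, mul_one]
  rw [e4, e5] at h7
  rw [e5] at h8
  exact ⟨h7, h8.trans h7.symm⟩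

theorem Exy (R : Rel3 ψ f) {x y : Fin (k + 3)} (hxy : x ≠ y) :
    Ex ψ f x * Ex ψ f y = Ex ψ f y * Ex ψ f x ∧
    Ex ψ f x * Ex ψ f y * ψ (swap x y) = Ex ψ f x * Ex ψ f y := by
  obtain ⟨σ, h0, h1⟩ : ∃ σ : Perm (Fin (k + 3)), σ 0 = x ∧ σ 1 = y := by
    refine ⟨swap (swap 0 x 1) y * swap 0 x, ?_, ?_⟩
    · rw [Perm.mul_apply, swap_apply_left]
      apply swap_apply_of_ne_of_ne _ hxy
      intro h
      rw [eq_comm, swap_apply_eq_iff, swap_apply_right] at h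
      simp at h
    · rw [Perm.mul_apply, swap_apply_left]
  obtain ⟨ha, hb⟩ := Ex01 R
  have c0 : Ex ψ f x = ψ σ * Ex ψ f 0 * ψ σ⁻¹ := by
    rw [conj_Ex R, h0, mul_assoc, psi_mul_inv, mul_one]
  have c1 : Ex ψ f y = ψ σ * Ex ψ f 1 * ψ σ⁻¹ := by
    rw [conj_Ex R, h1, mul_assoc, psi_mul_inv, mul_one]
  have c2 : ψ (swap x y) = ψ σ * ψ (swap 0 1) * ψ σ⁻¹ := by
    rw [← h0, ← h1, swap_apply_apply, map_mul, map_mul]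
  have cc : ∀ u v : Q, ψ σ * u * ψ σ⁻¹ * (ψ σ * v * ψ σ⁻¹) = ψ σ * (u * v) * ψ σ⁻¹ := by
    intro u v
    calc _ = ψ σ * u * (ψ σ⁻¹ * ψ σ) * v * ψ σ⁻¹ := by simp only [mul_assoc]
      _ = _ := by rw [psi_inv_mul]; simp only [mul_assoc, one_mul]
  rw [c0, c1, c2]
  simp only [cc, ha]
  rw [← ha, hb]
  exact ⟨trivial, rfl⟩

theorem Ex_comm (R : Rel3 ψ f) (x y : Fin (k + 3)) :
    Ex ψ f x * Ex ψ f y = Ex ψ f y * Ex ψ f x := by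
  by_cases h : x = y
  · rw [h]
  · exact (Exy R h).1

theorem Ex_EL_comm (R : Rel3 ψ f) (x : Fin (k + 3)) (l : List (Fin (k + 3))) :
    Ex ψ f x * EL ψ f l = EL ψ f l * Ex ψ f x := by
  induction l with
  | nil => simp [EL]
  | cons y l ih =>
    simp only [EL, List.map_cons, List.prod_cons] at ih ⊢
    rw [← mul_assoc, Ex_comm R, mul_assoc, ih, mul_assoc]

theorem EL_comm (R : Rel3 ψ f) (l' l : List (Fin (k + 3))) :
    EL ψ f l' * EL ψ f l = EL ψ f l * EL ψ f l' := by
  induction l' with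
  | nil => simp [EL]
  | cons y l' ih =>
    have e : EL ψ f (y :: l') = Ex ψ f y * EL ψ f l' := by simp [EL]
    rw [e, mul_assoc, ih, ← mul_assoc, Ex_EL_comm R, mul_assoc]

theorem Ex_absorb (R : Rel3 ψ f) (x : Fin (k + 3)) (l : List (Fin (k + 3))) (hx : x ∈ l) :
    Ex ψ f x * EL ψ f l = EL ψ f l := by
  induction l with
  | nil => simp at hx
  | cons y l ih =>
    have e : EL ψ f (y :: l) = Ex ψ f y * EL ψ f l := by simp [EL]
    rw [e, ← mul_assoc]
    by_cases h : x = y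
    · rw [h, Ex_idem R]
    · rw [Ex_comm R, mul_assoc, ih (by simpa [h] using hx)]

theorem EL_absorb (R : Rel3 ψ f) (l' l : List (Fin (k + 3))) (hx : ∀ x ∈ l', x ∈ l) :
    EL ψ f l' * EL ψ f l = EL ψ f l := by
  induction l' with
  | nil => simp [EL]
  | cons y l' ih =>
    have e : EL ψ f (y :: l') = Ex ψ f y * EL ψ f l' := by simp [EL]
    rw [e, mul_assoc, ih (fun x h => hx x (List.mem_cons_of_mem _ h)),
      Ex_absorb R y l (hx y List.mem_cons_self)]

theorem EL_congr (R : Rel3 ψ f) (l' l : List (Fin (k + 3))) (hx : ∀ x, x ∈ l' ↔ x ∈ l) :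
    EL ψ f l' = EL ψ f l := by
  rw [← EL_absorb R l' l (fun x => (hx x).1), EL_comm R, EL_absorb R l l' (fun x => (hx x).2)]

theorem EL_swap (R : Rel3 ψ f) (l : List (Fin (k + 3))) (x y : Fin (k + 3)) (hx : x ∈ l)
    (hy : y ∈ l) (hxy : x ≠ y) : EL ψ f l * ψ (swap x y) = EL ψ f l := by
  have h : EL ψ f l = EL ψ f l * (Ex ψ f x * Ex ψ f y) := by
    rw [← mul_assoc, ← Ex_EL_comm R, Ex_absorb R x l hx, ← Ex_EL_comm R, Ex_absorb R y l hy]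
  rw [h, mul_assoc, (Exy R hxy).2]

theorem EL_perm (R : Rel3 ψ f) (l : List (Fin (k + 3))) (σ : Perm (Fin (k + 3)))
    (hσ : ∀ x, x ∉ l → σ x = x) : EL ψ f l * ψ σ = EL ψ f l := by
  let N : Submonoid (Perm (Fin (k + 3))) :=
    { carrier := {σ | EL ψ f l * ψ σ = EL ψ f l}
      one_mem' := by simp
      mul_mem' := by
        intro a b ha hb
        simp only [Set.mem_ofPred_eq, map_mul] at *
        rw [← mul_assoc, ha, hb] }
  exact mem_of_support (fun x => x ∈ l) N (fun x y hx hy hxy => EL_swap R l x y hx hy hxy) σ hσ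

theorem NF_eq (R : Rel3 ψ f) (l l' : List (Fin (k + 3))) (σ σ' : Perm (Fin (k + 3)))
    (hl : ∀ x, x ∈ l' ↔ x ∈ l) (hσ : ∀ x, x ∉ l → σ⁻¹ x = σ'⁻¹ x) :
    EL ψ f l * ψ σ = EL ψ f l' * ψ σ' := by
  rw [EL_congr R l' l hl]
  have := EL_perm R l (σ' * σ⁻¹) (fun x hx => by
    rw [Perm.mul_apply, hσ x hx]; simp)
  conv_lhs => rw [← this]
  rw [mul_assoc, ← map_mul, inv_mul_cancel_right]

end abs

section concrete
variable {k : ℕ}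

theorem pf_mul_apply {V : Type*} (g h : V →. V) (x : V) : (g * h) x = (g x).bind h := rfl

theorem pf_mul_none {V : Type*} (g h : V →. V) (x : V) (hx : g x = Part.none) :
    (g * h) x = Part.none := by
  rw [pf_mul_apply, hx]; exact Part.bind_none h

theorem pf_mul_some {V : Type*} (g h : V →. V) (x y : V) (hx : g x = Part.some y) :
    (g * h) x = h y := by
  rw [pf_mul_apply, hx]; exact Part.bind_some y h

theorem pf_one_apply {V : Type*} (x : V) : (1 : V →. V) x = Part.some x := rfl

/-- The embedding of permutations into partial maps. -/
def iota (k : ℕ) : Perm (Fin (k + 3)) →* (Fin (k + 3) →. Fin (k + 3)) where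
  toFun σ := fun x => Part.some (σ⁻¹ x)
  map_one' := rfl
  map_mul' σ τ := by
    funext x
    exact (pf_mul_some (fun x => Part.some (σ⁻¹ x)) (fun x => Part.some (τ⁻¹ x)) x (σ⁻¹ x) rfl).symm

theorem iota_apply (σ : Perm (Fin (k + 3))) (x : Fin (k + 3)) :
    iota k σ x = Part.some (σ⁻¹ x) := rfl

/-- The partial identity missing the points of a list. -/
def miss (k : ℕ) (l : List (Fin (k + 3))) : Fin (k + 3) →. Fin (k + 3) :=
  fun x => if x ∈ l then Part.none else Part.some x

theorem miss_pos {l : List (Fin (k + 3))} {x : Fin (k + 3)} (h : x ∈ l) :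
    miss k l x = Part.none := if_pos h

theorem miss_neg {l : List (Fin (k + 3))} {x : Fin (k + 3)} (h : x ∉ l) :
    miss k l x = Part.some x := if_neg h

theorem miss_mul (l l' : List (Fin (k + 3))) : miss k l * miss k l' = miss k (l ++ l') := by
  funext x
  by_cases h : x ∈ l
  · rw [pf_mul_none _ _ _ (miss_pos h), miss_pos (List.mem_append_left _ h)]
  · rw [pf_mul_some _ _ _ _ (miss_neg h)]
    by_cases h' : x ∈ l'
    · rw [miss_pos h', miss_pos (List.mem_append_right _ h')]
    · rw [miss_neg h', miss_neg]
      simp [h, h']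

theorem iota_miss (σ : Perm (Fin (k + 3))) (l : List (Fin (k + 3))) :
    iota k σ * miss k l = miss k (l.map σ) * iota k σ := by
  funext x
  rw [pf_mul_some _ _ _ _ (iota_apply σ x)]
  have : σ⁻¹ x ∈ l ↔ x ∈ l.map σ := by
    rw [List.mem_map]
    constructor
    · intro h; exact ⟨_, h, by simp⟩
    · rintro ⟨y, hy, rfl⟩; simpa using hy
  by_cases h : σ⁻¹ x ∈ l
  · have h' := this.1 h
    rw [miss_pos h, pf_mul_none _ _ _ (miss_pos h')]
  · have h' := fun h' => h (this.2 h')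
    rw [miss_neg h, pf_mul_some _ _ _ _ (miss_neg h'), iota_apply]

theorem betaOne_eq : betaOne (k + 3) = miss k [Fin.last (k + 2)] := by
  funext x
  have h2 := x.2
  by_cases h : x = Fin.last (k + 2)
  · subst h; simp [betaOne, miss]
  · have : (x : ℕ) ≠ k + 2 := fun h' => h (Fin.ext h')
    simp only [betaOne, miss, List.mem_singleton, if_neg h]
    rw [if_pos (by omega)]

theorem swap01_eq : swap01 (k + 3) (by omega) = iota k (swap 0 1) := by
  funext x
  rw [iota_apply, swap_inv]
  unfold swap01
  congr 1
  by_cases h : x = 0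
  · subst h; simp
  by_cases h' : x = 1
  · subst h'; simp
  have e0 : ¬ (x : ℕ) = 0 := fun e => h (Fin.ext e)
  have e1 : ¬ (x : ℕ) = 1 := fun e => h' (by ext; simpa using e)
  rw [swap_apply_of_ne_of_ne h h', if_neg e0, if_neg e1]

theorem cyc_eq : cyc (k + 3) = iota k (finRotate (k + 3))⁻¹ := by
  funext x
  rw [iota_apply, inv_inv, finRotate_apply]
  unfold cyc
  congr 1
  ext
  have := x.2
  split_ifs with h
  · simp only [Fin.val_add, Fin.val_one]
    rw [h, show k + 3 - 1 + 1 = k + 3 by omega]; simp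
  · simp only [Fin.val_add, Fin.val_one]
    rw [Nat.mod_eq_of_lt (by omega)]

theorem iota_conj (σ : Perm (Fin (k + 3))) (l : List (Fin (k + 3))) :
    iota k σ * miss k l * iota k σ⁻¹ = miss k (l.map σ) := by
  rw [iota_miss, mul_assoc, psi_mul_inv, mul_one]

theorem miss_swap : miss k [0, 1] * iota k (swap 0 1) = miss k [0, 1] := by
  funext x
  by_cases h : x ∈ [0, 1]
  · rw [pf_mul_none _ _ _ (miss_pos h), miss_pos h]
  · rw [pf_mul_some _ _ _ _ (miss_neg h), miss_neg h, iota_apply, swap_inv, swap_apply_of_ne_of_ne]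
    · intro h'; apply h; simp [h']
    · intro h'; apply h; simp [h']

theorem miss_comm : miss k [1, 0] = miss k [0, 1] := by
  funext x; simp only [miss, List.mem_cons, List.not_mem_nil, or_false]
  simp only [or_comm]

theorem rel_iota : Rel3 (iota k) (betaOne (k + 3)) := by
  rw [betaOne_eq]
  have e0 : iota k (finRotate (k + 3)) * miss k [Fin.last (k + 2)] *
      iota k (finRotate (k + 3))⁻¹ = miss k [0] := by
    rw [iota_conj]; simp
  have e1 : iota k (swap 0 1) * miss k [0] = miss k [1] * iota k (swap 0 1) := by
    rw [iota_miss]; simp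
  have e2 : iota k (swap 0 1) * miss k [1] = miss k [0] * iota k (swap 0 1) := by
    rw [iota_miss]; simp
  have e3 : iota k (swap 0 1) * iota k (finRotate (k + 3)) * miss k [Fin.last (k + 2)] *
      iota k (finRotate (k + 3))⁻¹ = miss k [1] * iota k (swap 0 1) := by
    rw [← e1, ← e0]; simp only [mul_assoc]
  have e4 : (miss k [1] * iota k (swap 0 1)) ^ 2 = miss k [0, 1] := by
    rw [pow_two, mul_assoc, ← mul_assoc (iota k _), e2, mul_assoc, psi_swap, mul_one, miss_mul]
    exact miss_comm
  refine ⟨?_, ?_, ?_, ?_, ?_⟩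
  · rw [e0]
    have := iota_conj ((finRotate (k + 3))⁻¹ * swap 0 1) [(0 : Fin (k + 3))]
    rw [← e0, mul_inv_rev, inv_inv, swap_inv, map_mul, map_mul] at this
    simp only [mul_assoc] at this ⊢
    rw [this]
    congr 1
  · rw [e3, e0, e4, pow_two, mul_assoc, ← mul_assoc (iota k _), e1, mul_assoc, psi_swap, mul_one,
      miss_mul]; rfl
  · rw [e3, e4]
    have : iota k (finRotate (k + 3)) * miss k [Fin.last (k + 2)] * iota k (finRotate (k + 3))⁻¹ *
      iota k (swap 0 1) * iota k (finRotate (k + 3)) * miss k [Fin.last (k + 2)] *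
        iota k (finRotate (k + 3))⁻¹ = miss k [0] * (miss k [1] * iota k (swap 0 1)) := by
      rw [← e3, ← e0]; simp only [mul_assoc]
    rw [this, ← mul_assoc, miss_mul]
    exact miss_swap
  · rw [miss_mul]; funext x; simp [miss]
  · rw [iota_miss]
    congr 2

theorem EL_iota (l : List (Fin (k + 3))) : EL (iota k) (betaOne (k + 3)) l = miss k l := by
  induction l with
  | nil => funext x; simp [EL, miss, pf_one_apply]
  | cons y l ih =>
    have e : EL (iota k) (betaOne (k + 3)) (y :: l) = Ex (iota k) (betaOne (k + 3)) y *
      EL (iota k) (betaOne (k + 3)) l := by simp [EL]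
    rw [e, ih]
    have := iota_conj (swap (Fin.last (k + 2)) y) [Fin.last (k + 2)]
    rw [swap_inv] at this
    rw [Ex, betaOne_eq, this, miss_mul]
    simp

/-- The explicit normal form. -/
theorem nf_apply (l : List (Fin (k + 3))) (σ : Perm (Fin (k + 3))) (x : Fin (k + 3)) :
    (miss k l * iota k σ) x = if x ∈ l then Part.none else Part.some (σ⁻¹ x) := by
  split_ifs with h
  · exact pf_mul_none _ _ _ (miss_pos h)
  · rw [pf_mul_some _ _ _ _ (miss_neg h), iota_apply]

theorem nf_inj (l l' : List (Fin (k + 3))) (σ σ' : Perm (Fin (k + 3)))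
    (h : miss k l * iota k σ = miss k l' * iota k σ') :
    (∀ x, x ∈ l' ↔ x ∈ l) ∧ ∀ x, x ∉ l → σ⁻¹ x = σ'⁻¹ x := by
  have h1 : ∀ x, x ∈ l' ↔ x ∈ l := by
    intro x
    have := congrFun h x
    rw [nf_apply, nf_apply] at this
    by_cases a : x ∈ l <;> by_cases b : x ∈ l' <;> simp [a, b] at this ⊢
  refine ⟨h1, fun x hx => ?_⟩
  have := congrFun h x
  rw [nf_apply, nf_apply, if_neg hx, if_neg (fun h => hx ((h1 x).1 h))] at this
  exact Part.some_injective this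

theorem nf_exists (g : Fin (k + 3) →. Fin (k + 3)) (hg : PInj g) :
    ∃ l σ, g = miss k l * iota k σ := by
  classical
  let fn : {x // (g x).Dom} → Fin (k + 3) := fun x => (g x).get x.2
  have hfn : Function.Injective fn := by
    intro x y h
    apply Subtype.ext
    refine hg (a := fn x) (Part.get_mem x.2) ?_
    rw [h]; exact Part.get_mem y.2
  let e := Equiv.ofInjective fn hfn
  let τ : Perm (Fin (k + 3)) := Equiv.extendSubtype (p := fun x => (g x).Dom)
    (q := fun y => y ∈ Set.range fn) e
  refine ⟨(Finset.univ.filter (fun x => ¬ (g x).Dom)).toList, τ⁻¹, ?_⟩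
  funext x
  rw [nf_apply]
  simp only [Finset.mem_toList, Finset.mem_filter, Finset.mem_univ, true_and, inv_inv]
  by_cases hx : (g x).Dom
  · rw [if_neg (not_not.2 hx)]
    have : τ x = fn ⟨x, hx⟩ := Equiv.extendSubtype_apply_of_mem e x hx
    rw [this, eq_comm]
    exact Part.some_get hx
  · rw [if_pos hx]; exact Part.eq_none_iff'.2 hx

theorem nf_pinj (l : List (Fin (k + 3))) (σ : Perm (Fin (k + 3))) :
    PInj (miss k l * iota k σ) := by
  intro x y a hx hy
  rw [nf_apply] at hx hy
  split_ifs at hx hy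
  all_goals simp at hx hy
  exact σ⁻¹.injective (hx.symm.trans hy)

theorem cyc_pow : iota k (finRotate (k + 3))⁻¹ ^ (k + 2) = iota k (finRotate (k + 3)) := by
  rw [← map_pow, inv_pow]
  congr 1
  rw [inv_eq_iff_mul_eq_one, ← pow_succ, rot_pow]

theorem sound (hn : 4 ≤ k + 4) : conGen (R3 (k + 4)) ≤ Con.ker (phi3 (k + 4) hn) := by
  rw [Con.conGen_le]
  have p1 : phi3 (k + 4) hn va1 = iota k (finRotate (k + 3))⁻¹ := cyc_eq
  have p2 : phi3 (k + 4) hn va2 = iota k (swap 0 1) := swap01_eq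
  have p3 : phi3 (k + 4) hn vb1 = betaOne (k + 3) := rfl
  have R := rel_iota (k := k)
  have conj1 : (finRotate (k + 3)) * swap 0 1 * (finRotate (k + 3))⁻¹ =
      swap (1 : Fin (k + 3)) 2 := by
    rw [← swap_apply_apply, finRotate_apply, finRotate_apply]; congr 1
  intro u v huv
  rw [Con.ker_rel]
  rcases huv with ⟨rfl, rfl⟩ | ⟨rfl, rfl⟩ | ⟨rfl, rfl⟩ | ⟨rfl, rfl⟩ | ⟨j, h2, hj, rfl, rfl⟩ |
    ⟨rfl, rfl⟩ | ⟨rfl, rfl⟩ | ⟨rfl, rfl⟩ | ⟨rfl, rfl⟩ | ⟨rfl, rfl⟩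
  · rw [map_pow, p2, pow_two, psi_swap, map_one]
  · rw [map_pow, p1, ← map_pow, inv_pow, map_one]
    have := rot_pow k
    change iota k (finRotate (k + 3) ^ (k + 3))⁻¹ = 1
    rw [this, inv_one, map_one]
  · rw [map_pow, map_mul, p1, p2, ← map_mul, ← map_pow, map_one]
    rw [show k + 4 - 2 = k + 2 from rfl, rot_swap_pow, map_one]
  · rw [show k + 4 - 2 = k + 2 from rfl]
    simp only [map_mul, map_pow, p1, p2, cyc_pow, map_one]
    rw [mul_assoc, mul_assoc, ← mul_assoc (iota k (finRotate _)), ← map_mul, ← map_mul, ← map_mul,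
      ← map_pow, conj1]
    have h01 : (0 : Fin (k + 3)) ≠ 1 := by simp
    have h02 : (0 : Fin (k + 3)) ≠ 2 := by
      intro h; have := congrArg Fin.val h; simp at this; rw [Nat.mod_eq_of_lt (by omega)] at this; omega
    have h12 : (1 : Fin (k + 3)) ≠ 2 := by
      intro h; have := congrArg Fin.val h; simp at this; rw [Nat.mod_eq_of_lt (by omega)] at this; omega
    have : (swap (0 : Fin (k + 3)) 1 * swap 1 2) ^ 3 = 1 := by
      have a1 := swap_mul_swap_mul_swap h01 h02
      have a2 := swap_mul_swap_mul_swap h12.symm h02.symm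
      rw [swap_comm (1 : Fin (k + 3)) 0, swap_comm (2 : Fin (k + 3)) 1] at a2
      calc _ = (swap (0 : Fin (k + 3)) 1 * swap 1 2 * swap 0 1) *
            (swap 1 2 * swap 0 1 * swap 1 2) := by
            simp only [pow_succ, pow_zero, one_mul, mul_assoc]
        _ = 1 := by rw [a1, a2, swap_comm, swap_mul_self]
    rw [this, map_one]
  · rw [show k + 4 - 1 - j = k + 3 - j from rfl]
    have hj : j ≤ k + 1 := hj
    simp only [map_mul, map_pow, p1, p2, map_one]
    simp only [← map_mul, ← map_pow]
    have e : (finRotate (k + 3))⁻¹ ^ (k + 3 - j) = finRotate (k + 3) ^ j := by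
      rw [inv_pow, inv_eq_iff_mul_eq_one, ← pow_add, Nat.sub_add_cancel (by omega), rot_pow]
    rw [e, inv_pow, mul_assoc, mul_assoc, ← mul_assoc (_ ^ j), rot_conj k j (by omega)]
    have hd : Perm.Disjoint (swap (0 : Fin (k + 3)) 1)
        (swap (⟨j, by omega⟩ : Fin (k + 3)) ⟨j + 1, by omega⟩) := by
      intro x
      by_cases h1 : x = 0
      · right; subst h1
        apply swap_apply_of_ne_of_ne <;>
        · intro h; have := congrArg Fin.val h; simp at this; try omega
      by_cases h2 : x = 1
      · right; subst h2
        apply swap_apply_of_ne_of_ne <;>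
        · intro h; have := congrArg Fin.val h; simp at this; try omega
      · left; exact swap_apply_of_ne_of_ne h1 h2
    rw [hd.commute.mul_pow, pow_two, pow_two, swap_mul_self, swap_mul_self, mul_one, map_one]
  · rw [show k + 4 - 2 = k + 2 from rfl]
    simp only [map_mul, map_pow, p1, p2, p3, cyc_pow]
    exact R.h6
  · rw [show k + 4 - 2 = k + 2 from rfl]
    rw [map_pow, map_pow]
    simp only [map_mul, p1, p2, p3, map_pow, cyc_pow]
    exact R.h7
  · rw [show k + 4 - 2 = k + 2 from rfl]
    rw [map_pow]
    simp only [map_mul, p1, p2, p3, map_pow, cyc_pow]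
    exact R.h8
  · rw [map_pow, p3, pow_two]; exact R.h9
  · rw [map_mul, map_mul, p2, p3]; exact R.h10

theorem exists_rep (k : ℕ) (C : Con W3) (hC : C = conGen (R3 (k + 4))) :
    ∃ ψ : Perm (Fin (k + 3)) →* C.Quotient,
    ψ (finRotate (k + 3))⁻¹ = C.mk' va1 ∧ ψ (swap 0 1) = C.mk' va2 ∧ Rel3 ψ (C.mk' vb1) := by
  have rel : ∀ u v, R3 (k + 4) u v → C.mk' u = C.mk' v := fun u v h =>
    (Con.eq C).2 (hC ▸ ConGen.Rel.of u v h)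
  set a := C.mk' va1 with ha
  set t := C.mk' va2 with ht
  set f := C.mk' vb1 with hf
  have r1 : t ^ 2 = 1 := by
    have := rel (va2 ^ 2) 1 (Or.inl ⟨rfl, rfl⟩)
    simpa only [map_pow, map_one] using this
  have r2 : a ^ (k + 3) = 1 := by
    have := rel (va1 ^ (k + 3)) 1 (Or.inr <| Or.inl ⟨rfl, rfl⟩)
    simpa only [map_pow, map_one] using this
  have r3 : (a * t) ^ (k + 2) = 1 := by
    have := rel ((va1 * va2) ^ (k + 2)) 1 (Or.inr <| Or.inr <| Or.inl ⟨rfl, rfl⟩)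
    simpa only [map_pow, map_mul, map_one] using this
  have r4 : (t * a ^ (k + 2) * t * a) ^ 3 = 1 := by
    have := rel ((va2 * va1 ^ (k + 2) * va2 * va1) ^ 3) 1
      (Or.inr <| Or.inr <| Or.inr <| Or.inl ⟨rfl, rfl⟩)
    simpa only [map_pow, map_mul, map_one] using this
  have r5 : ∀ j, 2 ≤ j → j ≤ k + 1 → (t * a ^ (k + 3 - j) * t * a ^ j) ^ 2 = 1 := by
    intro j h2 hj
    have := rel ((va2 * va1 ^ (k + 3 - j) * va2 * va1 ^ j) ^ 2) 1
      (Or.inr <| Or.inr <| Or.inr <| Or.inr <| Or.inl ⟨j, h2, hj, rfl, rfl⟩)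
    simpa only [map_pow, map_mul, map_one] using this
  have r6 : a * t * a ^ (k + 2) * f * a * t * a ^ (k + 2) = a ^ (k + 2) * f * a := by
    have := rel _ _
      (Or.inr <| Or.inr <| Or.inr <| Or.inr <| Or.inr <| Or.inl ⟨rfl, rfl⟩)
    simp only [map_pow, map_mul, map_one] at this
    exact this
  have r7 : (a ^ (k + 2) * f * a * t) ^ 2 = (t * a ^ (k + 2) * f * a) ^ 2 := by
    have := rel _ _
      (Or.inr <| Or.inr <| Or.inr <| Or.inr <| Or.inr <| Or.inr <| Or.inl ⟨rfl, rfl⟩)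
    simp only [map_pow, map_mul, map_one] at this
    exact this
  have r8 : a ^ (k + 2) * f * a * t * a ^ (k + 2) * f * a = (t * a ^ (k + 2) * f * a) ^ 2 := by
    have := rel _ _
      (Or.inr <| Or.inr <| Or.inr <| Or.inr <| Or.inr <| Or.inr <| Or.inr <| Or.inl ⟨rfl, rfl⟩)
    simp only [map_pow, map_mul, map_one] at this
    exact this
  have r9 : f ^ 2 = f := by
    have := rel _ _
      (Or.inr <| Or.inr <| Or.inr <| Or.inr <| Or.inr <| Or.inr <| Or.inr <| Or.inr <|
        Or.inl ⟨rfl, rfl⟩)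
    simpa only [map_pow, map_mul, map_one] using this
  have r10 : t * f = f * t := by
    have := rel _ _
      (Or.inr <| Or.inr <| Or.inr <| Or.inr <| Or.inr <| Or.inr <| Or.inr <| Or.inr <|
        Or.inr ⟨rfl, rfl⟩)
    simpa only [map_pow, map_mul, map_one] using this
  let A : C.Quotientˣ := ⟨a, a ^ (k + 2), by rw [← pow_succ', r2], by rw [← pow_succ, r2]⟩
  let T : C.Quotientˣ := ⟨t, t, by rw [← pow_two, r1], by rw [← pow_two, r1]⟩
  have hA : (A : C.Quotient) = a := rfl
  have hT : (T : C.Quotient) = t := rfl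
  obtain ⟨ψ, h1, h2⟩ := moore_hom k A T (Units.ext (by push_cast; rw [hT, r1]))
    (Units.ext (by push_cast; rw [hA, r2])) (Units.ext (by push_cast; rw [hA, hT, r3]))
    (Units.ext (by push_cast; rw [hA, hT, r4]))
    (fun j hj hj' => Units.ext (by push_cast; rw [hA, hT, r5 j hj hj']))
  let Ψ : Perm (Fin (k + 3)) →* C.Quotient := (Units.coeHom _).comp ψ
  have H1 : Ψ (finRotate (k + 3))⁻¹ = a := by rw [← hA, ← h1]; rfl
  have H2 : Ψ (swap 0 1) = t := by rw [← hT, ← h2]; rfl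
  have H3 : Ψ (finRotate (k + 3)) = a ^ (k + 2) := by
    rw [← H1, ← map_pow, inv_pow]
    congr 1
    rw [eq_inv_iff_mul_eq_one, ← pow_succ', rot_pow]
  refine ⟨Ψ, H1, H2, ?_, ?_, ?_, ?_, ?_⟩
  · rw [H1, H2, H3]; exact r6
  · rw [H1, H2, H3]; exact r7
  · rw [H1, H2, H3]; exact r8
  · rw [← pow_two, r9]
  · rw [H2]; exact r10

theorem main (k : ℕ) (hn : 4 ≤ k + 4) :
    (∀ u v : W3, conGen (R3 (k + 4)) u v ↔ phi3 (k + 4) hn u = phi3 (k + 4) hn v) ∧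
    Set.range (phi3 (k + 4) hn) = { f : Fin (k + 3) →. Fin (k + 3) | PInj f } := by
  obtain ⟨C, hC⟩ : ∃ C, C = conGen (R3 (k + 4)) := ⟨_, rfl⟩
  obtain ⟨ψ, h1, h2, R⟩ := exists_rep k C hC
  have hsound : C ≤ Con.ker (phi3 (k + 4) hn) := hC ▸ sound hn
  rw [← hC]
  let π : C.Quotient →* (Fin (k + 3) →. Fin (k + 3)) := C.lift (phi3 (k + 4) hn) hsound
  have hπ : ∀ u, π (C.mk' u) = phi3 (k + 4) hn u := fun u => rfl
  have p1 : phi3 (k + 4) hn va1 = iota k (finRotate (k + 3))⁻¹ := cyc_eq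
  have p2 : phi3 (k + 4) hn va2 = iota k (swap 0 1) := swap01_eq
  have p3 : phi3 (k + 4) hn vb1 = betaOne (k + 3) := rfl
  have hψ : ∀ σ, π (ψ σ) = iota k σ := by
    have hc : Subgroup.closure ({finRotate (k + 3), swap 0 (finRotate (k + 3) 0)} :
        Set (Perm (Fin (k + 3)))) = ⊤ :=
      Perm.closure_cycle_adjacent_swap isCycle_finRotate support_finRotate 0
    have hu : (π.comp ψ).toHomUnits = (iota k).toHomUnits := by
      refine MonoidHom.eq_of_eqOn_dense hc ?_
      rintro _ (rfl | rfl)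
      · rw [← inv_inj, ← map_inv, ← map_inv]
        ext1
        simp only [MonoidHom.coe_toHomUnits, MonoidHom.comp_apply]
        rw [h1, hπ, p1]
      · ext1
        rw [finRotate_apply, zero_add]
        simp only [MonoidHom.coe_toHomUnits, MonoidHom.comp_apply]
        rw [h2, hπ, p2]
    intro σ
    exact congrArg Units.val (DFunLike.congr_fun hu σ)
  have hEL : ∀ l, π (EL ψ (C.mk' vb1) l) = miss k l := by
    intro l
    rw [← EL_iota]
    simp only [EL, map_list_prod, List.map_map]
    congr 2
    funext x
    simp only [Function.comp, Ex, map_mul, hψ, hπ, p3]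
  have hNF : ∀ u : W3, ∃ l σ, C.mk' u = EL ψ (C.mk' vb1) l * ψ σ := by
    intro u
    induction u using FreeMonoid.inductionOn' with
    | one => exact ⟨[], 1, by simp [EL]⟩
    | of_mul g u ih =>
      obtain ⟨l, σ, h⟩ := ih
      rw [map_mul, h]
      cases g with
      | a1 =>
        refine ⟨l.map ((finRotate (k + 3))⁻¹ : Perm (Fin (k + 3))), (finRotate (k + 3))⁻¹ * σ, ?_⟩
        change C.mk' va1 * _ = _
        rw [← h1, ← mul_assoc, conj_EL R, mul_assoc, map_mul]
      | a2 =>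
        refine ⟨l.map (swap 0 1), swap 0 1 * σ, ?_⟩
        change C.mk' va2 * _ = _
        rw [← h2, ← mul_assoc, conj_EL R, mul_assoc, map_mul]
      | b1 =>
        refine ⟨Fin.last (k + 2) :: l, σ, ?_⟩
        change C.mk' vb1 * _ = _
        rw [← mul_assoc]
        congr 1
        simp only [EL, List.map_cons, List.prod_cons]
        congr 1
        simp [Ex, Perm.one_def.symm]
  constructor
  · intro u v
    constructor
    · intro h; exact hsound h
    · intro h
      obtain ⟨l, σ, hu⟩ := hNF u
      obtain ⟨l', σ', hv⟩ := hNF v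
      rw [← hπ, ← hπ, hu, hv, map_mul, map_mul, hEL, hEL, hψ, hψ] at h
      obtain ⟨ha, hb⟩ := nf_inj _ _ _ _ h
      have := NF_eq R l l' σ σ' ha hb
      rw [← hu, ← hv] at this
      exact (Con.eq C).1 this
  · ext g
    constructor
    · rintro ⟨u, rfl⟩
      obtain ⟨l, σ, hu⟩ := hNF u
      rw [← hπ, hu, map_mul, hEL, hψ]
      exact nf_pinj l σ
    · intro hg
      obtain ⟨l, σ, rfl⟩ := nf_exists g hg
      obtain ⟨u, hu⟩ := Con.mk'_surjective (c := C) (EL ψ (C.mk' vb1) l * ψ σ)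
      refine ⟨u, ?_⟩
      rw [← hπ, hu, map_mul, hEL, hψ]

end concrete

/-- For `n ≥ 4`, the symmetric inverse monoid on `{1,...,n-1}` is defined by the
presentation `⟨a₁,a₂,b₁ | R3⟩`: the congruence generated by `R3` is the kernel of `φ3`,
and the image of `φ3` is exactly the set of injective partial maps. -/
theorem statement12 (n : ℕ) (hn : 4 ≤ n) :
    (∀ u v : W3, conGen (R3 n) u v ↔ phi3 n hn u = phi3 n hn v) ∧
    Set.range (phi3 n hn) = { f : Fin (n - 1) →. Fin (n - 1) | PInj f } := by
  obtain ⟨k, rfl⟩ : ∃ k, n = k + 4 := ⟨n - 4, by omega⟩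
  exact main k hn

end DPSPaper
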